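/- Let (R,S,P,Q,φ,ψ) be a Morita context over k. Then the enveloping algebras R ⊗_k R^op and S ⊗_k S^op are Morita equivalent: there is a k-linear equivalence between the category of left (R ⊗_k R^op)-modules and the category of left (S ⊗_k S^op)-modules. -/

import Mathlib

open scoped TensorProduct
open MulOpposite

universe u

/-- The `k`-submodule of balancing relations `(m·a) ⊗ n − m ⊗ (a·n)` inside `M ⊗[k] N`,
for a `k`-algebra `A`, a right `A`-module `M` and a left `A`-module `N`.  The balanced
tensor product `M ⊗_A N` is the quotient of `M ⊗[k] N` by this submodule. -/
def midRel (k A M N : Type u) [CommRing k] [Ring A] [Algebra k A]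
    [AddCommGroup M] [Module k M] [Module Aᵐᵒᵖ M]
    [AddCommGroup N] [Module k N] [Module A N] :
    Submodule k (TensorProduct k M N) :=
  Submodule.span k {x | ∃ (m : M) (a : A) (n : N),
    x = (op a • m) ⊗ₜ[k] n - m ⊗ₜ[k] (a • n)}

/-- A Morita context `(R, S, P, Q, φ, ψ)` over the commutative ground ring `k`:
`P` is an `(S,R)`-bimodule and `Q` an `(R,S)`-bimodule (both with symmetric `k`-action,
right actions being encoded as left actions of the opposite algebras), and `φ` and `ψ` are
`k`-bilinear pairings `P × Q → S` and `Q × P → R` which descend to bimodule isomorphisms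
`φ : P ⊗_R Q ≅ S` and `ψ : Q ⊗_S P ≅ R` on the balanced tensor products:  the lifted maps on
`P ⊗[k] Q` resp. `Q ⊗[k] P` are surjective and their kernels are exactly the corresponding
submodules of balancing relations (so that the induced maps on the quotients realizing
`P ⊗_R Q` and `Q ⊗_S P` are well defined bijections); moreover the compatibilities
`φ(p ⊗ q)·p' = p·ψ(q ⊗ p')` and `ψ(q ⊗ p)·q' = q·φ(p ⊗ q')` hold. -/
structure MoritaContext (k R S P Q : Type u) [CommRing k] [Ring R] [Ring S]
    [Algebra k R] [Algebra k S]
    [AddCommGroup P] [Module k P] [Module S P] [Module Rᵐᵒᵖ P]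
    [SMulCommClass S Rᵐᵒᵖ P] [IsScalarTower k S P] [IsScalarTower k Rᵐᵒᵖ P]
    [AddCommGroup Q] [Module k Q] [Module R Q] [Module Sᵐᵒᵖ Q]
    [SMulCommClass R Sᵐᵒᵖ Q] [IsScalarTower k R Q] [IsScalarTower k Sᵐᵒᵖ Q] : Type u where
  φ : P →ₗ[k] Q →ₗ[k] S
  ψ : Q →ₗ[k] P →ₗ[k] R
  φ_ker : LinearMap.ker (TensorProduct.lift φ) = midRel k R P Q
  φ_surj : Function.Surjective (TensorProduct.lift φ)
  ψ_ker : LinearMap.ker (TensorProduct.lift ψ) = midRel k S Q P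
  ψ_surj : Function.Surjective (TensorProduct.lift ψ)
  φ_left : ∀ (s : S) (p : P) (q : Q), φ (s • p) q = s * φ p q
  φ_right : ∀ (s : S) (p : P) (q : Q), φ p (op s • q) = φ p q * s
  ψ_left : ∀ (r : R) (q : Q) (p : P), ψ (r • q) p = r * ψ q p
  ψ_right : ∀ (r : R) (q : Q) (p : P), ψ q (op r • p) = ψ q p * r
  assoc_φψ : ∀ (p : P) (q : Q) (p' : P), φ p q • p' = op (ψ q p') • p
  assoc_ψφ : ∀ (q : Q) (p : P) (q' : Q), ψ q p • q' = op (φ p q') • q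


open CategoryTheory

/-- Scalar multiplication by `a : k` on a module over the `k`-algebra `A`, as an `A`-linear
endomorphism (`k` maps into the centre of `A`), i.e. as an endomorphism in `ModuleCat A`.
An additive functor `F` between such module categories is `k`-linear precisely if it
intertwines these endomorphisms. -/
def centralSmul (k : Type u) [CommRing k] (A : Type u) [Ring A] [Algebra k A]
    (M : ModuleCat.{u} A) (a : k) : M ⟶ M :=
  ModuleCat.ofHom (X := M) (Y := M)
  { toFun := fun x => algebraMap k A a • x
    map_add' := fun x y => smul_add _ x y
    map_smul' := fun c x => by
      simp only [RingHom.id_apply]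
      rw [smul_smul, smul_smul, Algebra.commutes] }

/-- For an `A`-module `X` with a commuting right action of `B`, the `B`-action
`(b • f) x = f (x · b)` on `A`-linear maps out of `X`. -/
@[reducible]
def domOpModule (A B X M : Type u) [Ring A] [Ring B] [AddCommGroup X] [Module A X]
    [Module Bᵐᵒᵖ X] [SMulCommClass A Bᵐᵒᵖ X] [AddCommGroup M] [Module A M] :
    Module B (X →ₗ[A] M) where
  smul b f :=
    { toFun := fun x => f (op b • x)
      map_add' := fun x y => by rw [smul_add, map_add]
      map_smul' := fun a x => by rw [← smul_comm a, map_smul, RingHom.id_apply] }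
  one_smul f := LinearMap.ext fun x => congrArg f (one_smul Bᵐᵒᵖ x)
  mul_smul b c f := LinearMap.ext fun x => congrArg f (mul_smul (op c) (op b) x)
  smul_zero b := LinearMap.ext fun x => rfl
  smul_add b f g := LinearMap.ext fun x => rfl
  add_smul b c f := LinearMap.ext fun x =>
    (congrArg f (add_smul (op b) (op c) x)).trans (map_add f _ _)
  zero_smul f := LinearMap.ext fun x => (congrArg f (zero_smul Bᵐᵒᵖ x)).trans (map_zero f)

section HomEquivalence

attribute [local instance] domOpModule

theorem domOpModule_smul_apply {A B X M : Type u} [Ring A] [Ring B] [AddCommGroup X]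
    [Module A X] [Module Bᵐᵒᵖ X] [SMulCommClass A Bᵐᵒᵖ X] [AddCommGroup M] [Module A M]
    (b : B) (f : X →ₗ[A] M) (x : X) : (b • f) x = f (op b • x) := rfl

/-- The functor `Hom_A(X, -)` from `A`-modules to `B`-modules, for an `(A, B)`-bimodule `X`. -/
def homFunctor (A B X : Type u) [Ring A] [Ring B] [AddCommGroup X] [Module A X]
    [Module Bᵐᵒᵖ X] [SMulCommClass A Bᵐᵒᵖ X] : ModuleCat.{u} A ⥤ ModuleCat.{u} B where
  obj M := ModuleCat.of B (X →ₗ[A] M)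
  map {M N} g := ModuleCat.ofHom (X := X →ₗ[A] M) (Y := X →ₗ[A] N)
    { toFun := fun f => g.hom ∘ₗ f
      map_add' := fun f f' => LinearMap.comp_add f f' g.hom
      map_smul' := fun _ _ => rfl }
  map_id _ := rfl
  map_comp _ _ := rfl

instance homFunctor_additive (A B X : Type u) [Ring A] [Ring B] [AddCommGroup X] [Module A X]
    [Module Bᵐᵒᵖ X] [SMulCommClass A Bᵐᵒᵖ X] : (homFunctor A B X).Additive where
  map_add := rfl

variable {A B X Y : Type u} [Ring A] [Ring B]
  [AddCommGroup X] [Module A X] [Module Bᵐᵒᵖ X] [SMulCommClass A Bᵐᵒᵖ X]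
  [AddCommGroup Y] [Module B Y] [Module Aᵐᵒᵖ Y] [SMulCommClass B Aᵐᵒᵖ Y]

/-- A biadditive pairing `X × Y → A` which is balanced over `B`, is `A`-linear on both sides,
and whose values generate `A` additively. -/
structure IsFullPairing (ψ : X → Y → A) : Prop where
  add_left : ∀ x x' y, ψ (x + x') y = ψ x y + ψ x' y
  add_right : ∀ x y y', ψ x (y + y') = ψ x y + ψ x y'
  smul_left : ∀ (a : A) x y, ψ (a • x) y = a * ψ x y
  smul_right : ∀ (a : A) x y, ψ x (op a • y) = ψ x y * a
  balanced : ∀ (b : B) x y, ψ (op b • x) y = ψ x (b • y)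
  one_mem : (1 : A) ∈ AddSubgroup.closure {a | ∃ x y, ψ x y = a}

/-- The natural map `M → Hom_B(Y, Hom_A(X, M))` induced by a pairing `X × Y → A`. -/
def IsFullPairing.toHomHom {ψ : X → Y → A} (hψ : IsFullPairing (B := B) ψ) (M : Type u)
    [AddCommGroup M] [Module A M] : M →ₗ[A] Y →ₗ[B] X →ₗ[A] M where
  toFun m :=
    { toFun := fun y =>
        { toFun := fun x => ψ x y • m
          map_add' := fun x x' => by rw [hψ.add_left, add_smul]
          map_smul' := fun a x => by rw [hψ.smul_left, mul_smul, RingHom.id_apply] }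
      map_add' := fun y y' => LinearMap.ext fun x =>
        (congrArg (· • m) (hψ.add_right x y y')).trans (add_smul _ _ m)
      map_smul' := fun b y => LinearMap.ext fun x =>
        congrArg (· • m) (hψ.balanced b x y).symm }
  map_add' m m' := LinearMap.ext fun y => LinearMap.ext fun x => smul_add (ψ x y) m m'
  map_smul' a m := LinearMap.ext fun y => LinearMap.ext fun x =>
    (mul_smul (ψ x y) a m).symm.trans (congrArg (· • m) (hψ.smul_right a x y).symm)

theorem IsFullPairing.toHomHom_apply {ψ : X → Y → A} (hψ : IsFullPairing (B := B) ψ)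
    {M : Type u} [AddCommGroup M] [Module A M] (m : M) (y : Y) (x : X) :
    hψ.toHomHom M m y x = ψ x y • m := rfl

theorem IsFullPairing.toHomHom_bijective {ψ : X → Y → A} (hψ : IsFullPairing (B := B) ψ)
    (φ : Y → X → B) (assoc_left : ∀ x y x', ψ x y • x' = op (φ y x') • x)
    (assoc_right : ∀ y x y', φ y x • y' = op (ψ x y') • y) (M : Type u)
    [AddCommGroup M] [Module A M] : Function.Bijective (hψ.toHomHom M) := by
  constructor
  · rw [injective_iff_map_eq_zero]
    intro m hm
    have key : ∀ a ∈ AddSubgroup.closure {a | ∃ x y, ψ x y = a}, a • m = 0 := by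
      intro a ha
      induction ha using AddSubgroup.closure_induction with
      | mem a ha =>
        obtain ⟨x, y, rfl⟩ := ha
        rw [← hψ.toHomHom_apply, hm]
        rfl
      | zero => exact zero_smul A m
      | add a b _ _ ha hb => rw [add_smul, ha, hb, add_zero]
      | neg a _ ha => rw [neg_smul, ha, neg_zero]
    simpa using key 1 hψ.one_mem
  · intro f
    have key : ∀ a ∈ AddSubgroup.closure {a | ∃ x y, ψ x y = a},
        ∃ m : M, ∀ x y, ψ x y • m = f (op a • y) x := by
      intro a ha
      induction ha using AddSubgroup.closure_induction with
      | mem a ha =>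
        obtain ⟨x', y', rfl⟩ := ha
        refine ⟨f y' x', fun x y => ?_⟩
        rw [← map_smul (f y'), assoc_left, ← assoc_right, map_smul f, domOpModule_smul_apply]
      | zero => exact ⟨0, fun x y => by simp⟩
      | add a b _ _ ha hb =>
        obtain ⟨m, hm⟩ := ha
        obtain ⟨n, hn⟩ := hb
        exact ⟨m + n, fun x y => by
          rw [smul_add, hm, hn, MulOpposite.op_add, add_smul, map_add, LinearMap.add_apply]⟩
      | neg a _ ha =>
        obtain ⟨m, hm⟩ := ha
        exact ⟨-m, fun x y => by
          rw [smul_neg, hm, MulOpposite.op_neg, neg_smul, map_neg, LinearMap.neg_apply]⟩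
    obtain ⟨m, hm⟩ := key 1 hψ.one_mem
    exact ⟨m, LinearMap.ext fun y => LinearMap.ext fun x => by
      rw [hψ.toHomHom_apply, hm, op_one, one_smul]⟩

/-- The natural isomorphism `M ≅ Hom_B(Y, Hom_A(X, M))` induced by a full pairing. -/
noncomputable def IsFullPairing.unitIso {ψ : X → Y → A} (hψ : IsFullPairing (B := B) ψ)
    (φ : Y → X → B) (assoc_left : ∀ x y x', ψ x y • x' = op (φ y x') • x)
    (assoc_right : ∀ y x y', φ y x • y' = op (ψ x y') • y) :
    𝟭 (ModuleCat.{u} A) ≅ homFunctor A B X ⋙ homFunctor B A Y :=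
  NatIso.ofComponents
    (fun M => (LinearEquiv.ofBijective (hψ.toHomHom M)
      (hψ.toHomHom_bijective φ assoc_left assoc_right M)).toModuleIso)
    (fun g => ModuleCat.hom_ext <| LinearMap.ext fun m => LinearMap.ext fun y =>
      LinearMap.ext fun x => (map_smul g.hom (ψ x y) m).symm)

/-- Two full pairings `X × Y → A` and `Y × X → B` satisfying the associativity relations make
`Hom_A(X, -)` an equivalence of module categories. -/
noncomputable def homEquivalence {ψ : X → Y → A} {φ : Y → X → B}
    (hψ : IsFullPairing (B := B) ψ) (hφ : IsFullPairing (B := A) φ)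
    (assoc_left : ∀ x y x', ψ x y • x' = op (φ y x') • x)
    (assoc_right : ∀ y x y', φ y x • y' = op (ψ x y') • y) :
    ModuleCat.{u} A ≌ ModuleCat.{u} B :=
  CategoryTheory.Equivalence.mk (homFunctor A B X) (homFunctor B A Y)
    (hψ.unitIso φ assoc_left assoc_right) (hφ.unitIso ψ assoc_right assoc_left).symm

theorem homFunctor_map_centralSmul (k : Type u) [CommRing k] [Algebra k A] [Algebra k B]
    (hX : ∀ (a : k) (x : X), op (algebraMap k B a) • x = algebraMap k A a • x)
    (M : ModuleCat.{u} A) (a : k) :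
    (homFunctor A B X).map (centralSmul k A M a)
      = centralSmul k B ((homFunctor A B X).obj M) a :=
  ModuleCat.hom_ext <| LinearMap.ext fun (f : X →ₗ[A] M) => LinearMap.ext fun (x : X) =>
    (map_smul f (algebraMap k A a) x).symm.trans (congrArg f (hX a x).symm)

end HomEquivalence

section TensorModule

variable (k C D U V : Type u) [CommRing k] [Ring C] [Algebra k C] [Ring D] [Algebra k D]
  [AddCommGroup U] [Module k U] [AddCommGroup V] [Module k V]

/-- The external tensor product of a `C`-module and a `D`-module, as a `C ⊗[k] D`-module. -/
@[reducible]
noncomputable def tensorModule [Module C U] [IsScalarTower k C U] [Module D V]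
    [IsScalarTower k D V] : Module (C ⊗[k] D) (U ⊗[k] V) :=
  Module.compHom _ ((Module.endTensorEndAlgHom (R := k) (S := k) (A := k) (M := U) (N := V)).comp
    (Algebra.TensorProduct.map (Algebra.lsmul k k U) (Algebra.lsmul k k V))).toRingHom

/-- The external tensor product of a right `C`-module and a left `D`-module, as a right
`C ⊗[k] Dᵐᵒᵖ`-module. -/
@[reducible]
noncomputable def tensorOpModule [Module Cᵐᵒᵖ U] [IsScalarTower k Cᵐᵒᵖ U] [Module D V]
    [IsScalarTower k D V] : Module (C ⊗[k] Dᵐᵒᵖ)ᵐᵒᵖ (U ⊗[k] V) :=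
  letI := tensorModule k Cᵐᵒᵖ D U V
  Module.compHom _
    ((Algebra.TensorProduct.congr AlgEquiv.refl (AlgEquiv.opOp k D).symm).toAlgHom.comp
      (Algebra.TensorProduct.opAlgEquiv k k C Dᵐᵒᵖ).symm.toAlgHom).toRingHom

attribute [local instance] tensorModule tensorOpModule

variable {k C D U V}

theorem tensorModule_zero_smul [Module C U] [IsScalarTower k C U] [Module D V]
    [IsScalarTower k D V] (x : U ⊗[k] V) : (0 : C ⊗[k] D) • x = 0 :=
  zero_smul (C ⊗[k] D) x

theorem tensorOpModule_op_zero_smul [Module Cᵐᵒᵖ U] [IsScalarTower k Cᵐᵒᵖ U] [Module D V]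
    [IsScalarTower k D V] (x : U ⊗[k] V) : op (0 : C ⊗[k] Dᵐᵒᵖ) • x = 0 :=
  zero_smul (C ⊗[k] Dᵐᵒᵖ)ᵐᵒᵖ x

theorem tensorModule_tmul_smul_tmul [Module C U] [IsScalarTower k C U] [Module D V]
    [IsScalarTower k D V] (c : C) (d : D) (u : U) (v : V) :
    (c ⊗ₜ[k] d) • (u ⊗ₜ[k] v) = (c • u) ⊗ₜ[k] (d • v) := rfl

theorem tensorOpModule_op_tmul_smul_tmul [Module Cᵐᵒᵖ U] [IsScalarTower k Cᵐᵒᵖ U] [Module D V]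
    [IsScalarTower k D V] (c : C) (d : D) (u : U) (v : V) :
    op (c ⊗ₜ[k] op d) • (u ⊗ₜ[k] v) = (op c • u) ⊗ₜ[k] (d • v) := rfl

theorem tensorModule_smulCommClass {E F : Type u} [Ring E] [Algebra k E] [Ring F] [Algebra k F]
    [Module C U] [IsScalarTower k C U] [Module D V] [IsScalarTower k D V]
    [Module Eᵐᵒᵖ U] [IsScalarTower k Eᵐᵒᵖ U] [Module F V] [IsScalarTower k F V]
    [SMulCommClass C Eᵐᵒᵖ U] [SMulCommClass D F V] :
    SMulCommClass (C ⊗[k] D) (E ⊗[k] Fᵐᵒᵖ)ᵐᵒᵖ (U ⊗[k] V) where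
  smul_comm a b x := by
    induction b using MulOpposite.rec' with | _ b
    induction x using TensorProduct.induction_on with
    | zero => simp only [smul_zero]
    | add x y hx hy => simp only [smul_add, hx, hy]
    | tmul u v =>
      induction a using TensorProduct.induction_on with
      | zero => simp only [tensorModule_zero_smul, smul_zero]
      | add a a' ha ha' => simp only [add_smul, smul_add, ha, ha']
      | tmul c d =>
        induction b using TensorProduct.induction_on with
        | zero => simp only [tensorOpModule_op_zero_smul, smul_zero]
        | add b b' hb hb' => simp only [MulOpposite.op_add, add_smul, smul_add, hb, hb']
        | tmul e f =>
          induction f using MulOpposite.rec' with | _ f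
          simp only [tensorModule_tmul_smul_tmul, tensorOpModule_op_tmul_smul_tmul,
            smul_comm c, smul_comm d]

end TensorModule

namespace MoritaContext

variable {k R S P Q : Type u} [CommRing k] [Ring R] [Ring S] [Algebra k R] [Algebra k S]
  [AddCommGroup P] [Module k P] [Module S P] [Module Rᵐᵒᵖ P]
  [SMulCommClass S Rᵐᵒᵖ P] [IsScalarTower k S P] [IsScalarTower k Rᵐᵒᵖ P]
  [AddCommGroup Q] [Module k Q] [Module R Q] [Module Sᵐᵒᵖ Q]
  [SMulCommClass R Sᵐᵒᵖ Q] [IsScalarTower k R Q] [IsScalarTower k Sᵐᵒᵖ Q]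

/-- The Morita context with the roles of the two algebras exchanged. -/
def symm (ctx : MoritaContext k R S P Q) : MoritaContext k S R Q P where
  φ := ctx.ψ
  ψ := ctx.φ
  φ_ker := ctx.ψ_ker
  φ_surj := ctx.ψ_surj
  ψ_ker := ctx.φ_ker
  ψ_surj := ctx.φ_surj
  φ_left := ctx.ψ_left
  φ_right := ctx.ψ_right
  ψ_left := ctx.φ_left
  ψ_right := ctx.φ_right
  assoc_φψ := ctx.assoc_ψφ
  assoc_ψφ := ctx.assoc_φψ

theorem ψ_balanced (ctx : MoritaContext k R S P Q) (s : S) (q : Q) (p : P) :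
    ctx.ψ (op s • q) p = ctx.ψ q (s • p) := by
  have h : (op s • q) ⊗ₜ[k] p - q ⊗ₜ[k] (s • p) ∈ LinearMap.ker (TensorProduct.lift ctx.ψ) :=
    ctx.ψ_ker ▸ Submodule.subset_span ⟨q, s, p, rfl⟩
  simpa [sub_eq_zero] using h

/-- The pairing `(q ⊗ p, p' ⊗ q') ↦ ψ (q ⊗ p') ⊗ ψ (q' ⊗ p)` with values in the enveloping
algebra of `R`. -/
noncomputable def envPairing (ctx : MoritaContext k R S P Q) :
    Q ⊗[k] P →ₗ[k] P ⊗[k] Q →ₗ[k] R ⊗[k] Rᵐᵒᵖ :=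
  TensorProduct.map₂ ctx.ψ (ctx.ψ.flip.compr₂ (opLinearEquiv k).toLinearMap)

theorem envPairing_tmul (ctx : MoritaContext k R S P Q) (q : Q) (p : P) (p' : P) (q' : Q) :
    ctx.envPairing (q ⊗ₜ p) (p' ⊗ₜ q') = ctx.ψ q p' ⊗ₜ op (ctx.ψ q' p) := rfl

attribute [local instance] tensorModule tensorOpModule

theorem envPairing_smul_left (ctx : MoritaContext k R S P Q) (a : R ⊗[k] Rᵐᵒᵖ) (x : Q ⊗[k] P)
    (y : P ⊗[k] Q) : ctx.envPairing (a • x) y = a * ctx.envPairing x y := by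
  induction x using TensorProduct.induction_on with
  | zero => simp only [smul_zero, map_zero, LinearMap.zero_apply, mul_zero]
  | add x x' hx hx' => simp only [smul_add, map_add, LinearMap.add_apply, mul_add, hx, hx']
  | tmul q p =>
    induction y using TensorProduct.induction_on with
    | zero => simp only [map_zero, mul_zero]
    | add y y' hy hy' => simp only [map_add, mul_add, hy, hy']
    | tmul p' q' =>
      induction a using TensorProduct.induction_on with
      | zero => simp only [tensorModule_zero_smul, map_zero, LinearMap.zero_apply, zero_mul]
      | add a a' ha ha' => simp only [add_smul, map_add, LinearMap.add_apply, add_mul, ha, ha']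
      | tmul r r' =>
        induction r' using MulOpposite.rec' with | _ r'
        rw [tensorModule_tmul_smul_tmul, envPairing_tmul, envPairing_tmul, ctx.ψ_left,
          ctx.ψ_right, Algebra.TensorProduct.tmul_mul_tmul, op_mul]

theorem envPairing_smul_right (ctx : MoritaContext k R S P Q) (a : R ⊗[k] Rᵐᵒᵖ) (x : Q ⊗[k] P)
    (y : P ⊗[k] Q) : ctx.envPairing x (op a • y) = ctx.envPairing x y * a := by
  induction x using TensorProduct.induction_on with
  | zero => simp only [map_zero, LinearMap.zero_apply, zero_mul]
  | add x x' hx hx' => simp only [map_add, LinearMap.add_apply, add_mul, hx, hx']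
  | tmul q p =>
    induction y using TensorProduct.induction_on with
    | zero => simp only [smul_zero, map_zero, zero_mul]
    | add y y' hy hy' => simp only [smul_add, map_add, add_mul, hy, hy']
    | tmul p' q' =>
      induction a using TensorProduct.induction_on with
      | zero => simp only [tensorOpModule_op_zero_smul, map_zero, mul_zero]
      | add a a' ha ha' => simp only [MulOpposite.op_add, add_smul, map_add, mul_add, ha, ha']
      | tmul r r' =>
        induction r' using MulOpposite.rec' with | _ r'
        rw [tensorOpModule_op_tmul_smul_tmul, envPairing_tmul, envPairing_tmul, ctx.ψ_left,
          ctx.ψ_right, Algebra.TensorProduct.tmul_mul_tmul, op_mul]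

theorem envPairing_balanced (ctx : MoritaContext k R S P Q) (b : S ⊗[k] Sᵐᵒᵖ) (x : Q ⊗[k] P)
    (y : P ⊗[k] Q) : ctx.envPairing (op b • x) y = ctx.envPairing x (b • y) := by
  induction x using TensorProduct.induction_on with
  | zero => simp only [smul_zero, map_zero, LinearMap.zero_apply]
  | add x x' hx hx' => simp only [smul_add, map_add, LinearMap.add_apply, hx, hx']
  | tmul q p =>
    induction y using TensorProduct.induction_on with
    | zero => simp only [smul_zero, map_zero]
    | add y y' hy hy' => simp only [smul_add, map_add, hy, hy']
    | tmul p' q' =>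
      induction b using TensorProduct.induction_on with
      | zero =>
        simp only [tensorOpModule_op_zero_smul, tensorModule_zero_smul, map_zero,
          LinearMap.zero_apply]
      | add b b' hb hb' =>
        simp only [MulOpposite.op_add, add_smul, map_add, LinearMap.add_apply, hb, hb']
      | tmul s s' =>
        induction s' using MulOpposite.rec' with | _ s'
        rw [tensorOpModule_op_tmul_smul_tmul, tensorModule_tmul_smul_tmul, envPairing_tmul,
          envPairing_tmul, ctx.ψ_balanced, ctx.ψ_balanced]

theorem one_mem_closure_envPairing (ctx : MoritaContext k R S P Q) :
    (1 : R ⊗[k] Rᵐᵒᵖ) ∈ AddSubgroup.closure {a | ∃ x y, ctx.envPairing x y = a} := by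
  obtain ⟨t, ht⟩ := ctx.ψ_surj 1
  obtain ⟨s, rfl⟩ := TensorProduct.exists_finset t
  simp only [map_sum, TensorProduct.lift.tmul] at ht
  rw [Algebra.TensorProduct.one_def, ← MulOpposite.op_one, ← ht, TensorProduct.sum_tmul]
  refine sum_mem fun i _ => ?_
  rw [Finset.op_sum, TensorProduct.tmul_sum]
  exact sum_mem fun j _ => AddSubgroup.subset_closure ⟨i.1 ⊗ₜ j.2, i.2 ⊗ₜ j.1, rfl⟩

theorem isFullPairing_envPairing (ctx : MoritaContext k R S P Q) :
    IsFullPairing (A := R ⊗[k] Rᵐᵒᵖ) (B := S ⊗[k] Sᵐᵒᵖ) (X := Q ⊗[k] P) (Y := P ⊗[k] Q)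
      (fun x y => ctx.envPairing x y) where
  add_left x x' y := LinearMap.map_add₂ _ x x' y
  add_right x := map_add (ctx.envPairing x)
  smul_left := ctx.envPairing_smul_left
  smul_right := ctx.envPairing_smul_right
  balanced := ctx.envPairing_balanced
  one_mem := ctx.one_mem_closure_envPairing

theorem envPairing_smul (ctx : MoritaContext k R S P Q) (x : Q ⊗[k] P) (y : P ⊗[k] Q)
    (z : Q ⊗[k] P) : ctx.envPairing x y • z = op (ctx.symm.envPairing y z) • x := by
  induction x using TensorProduct.induction_on with
  | zero => simp only [smul_zero, map_zero, LinearMap.zero_apply, tensorModule_zero_smul]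
  | add x x' hx hx' => simp only [smul_add, map_add, LinearMap.add_apply, add_smul, hx, hx']
  | tmul q p =>
    induction y using TensorProduct.induction_on with
    | zero =>
      simp only [map_zero, LinearMap.zero_apply, tensorOpModule_op_zero_smul,
        tensorModule_zero_smul]
    | add y y' hy hy' =>
      simp only [map_add, LinearMap.add_apply, MulOpposite.op_add, add_smul, hy, hy']
    | tmul p' q' =>
      induction z using TensorProduct.induction_on with
      | zero => simp only [smul_zero, map_zero, tensorOpModule_op_zero_smul]
      | add z z' hz hz' => simp only [smul_add, map_add, MulOpposite.op_add, add_smul, hz, hz']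
      | tmul q'' p'' =>
        rw [envPairing_tmul, envPairing_tmul, tensorModule_tmul_smul_tmul,
          tensorOpModule_op_tmul_smul_tmul, ctx.assoc_ψφ, ← ctx.assoc_φψ]
        rfl

end MoritaContext

theorem tensorOpModule_op_algebraMap_smul {k C D E F U V : Type u} [CommRing k]
    [Ring C] [Algebra k C] [Ring D] [Algebra k D] [Ring E] [Algebra k E] [Ring F] [Algebra k F]
    [AddCommGroup U] [Module k U] [AddCommGroup V] [Module k V]
    [Module C U] [IsScalarTower k C U] [Module D V] [IsScalarTower k D V]
    [Module Eᵐᵒᵖ U] [IsScalarTower k Eᵐᵒᵖ U] [Module F V] [IsScalarTower k F V]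
    (a : k) (x : U ⊗[k] V) :
    letI := tensorModule k C D U V
    letI := tensorOpModule k E F U V
    op (algebraMap k (E ⊗[k] Fᵐᵒᵖ) a) • x = algebraMap k (C ⊗[k] D) a • x := by
  let := tensorModule k C D U V
  let := tensorOpModule k E F U V
  induction x using TensorProduct.induction_on with
  | zero => simp only [smul_zero]
  | add x y hx hy => simp only [smul_add, hx, hy]
  | tmul u v =>
    refine (congrArg₂ (· ⊗ₜ[k] ·) ?_ ?_ : (op (algebraMap k E a) • u) ⊗ₜ[k] ((1 : F) • v)
      = (algebraMap k C a • u) ⊗ₜ[k] ((1 : D) • v))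
    · rw [← MulOpposite.algebraMap_apply, algebraMap_smul, algebraMap_smul]
    · rw [one_smul, one_smul]

/-- Let `(R, S, P, Q, φ, ψ)` be a Morita context over `k`.  Then the
enveloping algebras `R ⊗_k R^op` and `S ⊗_k S^op` are Morita equivalent:  there is a
`k`-linear (additive) equivalence between the category of left `R ⊗_k R^op`-modules and the
category of left `S ⊗_k S^op`-modules («`k`-linear» being expressed by the fact that the
functor commutes with the scalar action of `k`, which acts centrally on all modules). -/
theorem enveloping_algebras_morita_equivalent
    (k R S P Q : Type u) [CommRing k] [Ring R] [Ring S] [Algebra k R] [Algebra k S]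
    [AddCommGroup P] [Module k P] [Module S P] [Module Rᵐᵒᵖ P]
    [SMulCommClass S Rᵐᵒᵖ P] [IsScalarTower k S P] [IsScalarTower k Rᵐᵒᵖ P]
    [AddCommGroup Q] [Module k Q] [Module R Q] [Module Sᵐᵒᵖ Q]
    [SMulCommClass R Sᵐᵒᵖ Q] [IsScalarTower k R Q] [IsScalarTower k Sᵐᵒᵖ Q]
    (ctx : MoritaContext k R S P Q) :
    ∃ e : ModuleCat.{u} (R ⊗[k] Rᵐᵒᵖ) ≌ ModuleCat.{u} (S ⊗[k] Sᵐᵒᵖ),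
      e.functor.Additive ∧
      ∀ (M : ModuleCat.{u} (R ⊗[k] Rᵐᵒᵖ)) (a : k),
        e.functor.map (centralSmul k (R ⊗[k] Rᵐᵒᵖ) M a)
          = centralSmul k (S ⊗[k] Sᵐᵒᵖ) (e.functor.obj M) a := by
  let := tensorModule k R Rᵐᵒᵖ Q P
  let := tensorOpModule k S S Q P
  let := tensorModule k S Sᵐᵒᵖ P Q
  let := tensorOpModule k R R P Q
  have : SMulCommClass Rᵐᵒᵖ S P := SMulCommClass.symm _ _ _
  have : SMulCommClass Sᵐᵒᵖ R Q := SMulCommClass.symm _ _ _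
  have : SMulCommClass (R ⊗[k] Rᵐᵒᵖ) (S ⊗[k] Sᵐᵒᵖ)ᵐᵒᵖ (Q ⊗[k] P) := tensorModule_smulCommClass
  have : SMulCommClass (S ⊗[k] Sᵐᵒᵖ) (R ⊗[k] Rᵐᵒᵖ)ᵐᵒᵖ (P ⊗[k] Q) := tensorModule_smulCommClass
  exact ⟨homEquivalence ctx.isFullPairing_envPairing ctx.symm.isFullPairing_envPairing
      ctx.envPairing_smul ctx.symm.envPairing_smul,
    homFunctor_additive (R ⊗[k] Rᵐᵒᵖ) (S ⊗[k] Sᵐᵒᵖ) (Q ⊗[k] P),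
    homFunctor_map_centralSmul k tensorOpModule_op_algebraMap_smul⟩
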